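/- Let α, β be real, θ > 0, and let p1, p2 : ℕ → ℝ be strictly positive functions (probability mass functions of two independent random variables X1, X2). Suppose that for every nonnegative integer y and every x ∈ {0,…,y}, the conditional probability p1(x)·p2(y−x) / Σ_{k=0}^y p1(k)·p2(y−k) equals the MCMPB_y(α,β,θ) probability mass function θ^x/((x!)^α ((y−x)!)^β C_y(α,β,θ)). Then, with a = p2(1)/p2(0) and b = p1(0)/p1(1), one has a·b·θ = 1, p1(x) = (aθ)^x/(x!)^α · p1(0) for all x ≥ 0, and p2(y) = a^y/(y!)^β · p2(0) for all y ≥ 0; that is, X1 is distributed as CMP(α, aθ) and X2 as CMP(β, a). -/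

import Mathlib

/-- Normalizing constant of the MCMPB distribution:
`C_n(α,β,θ) = ∑_{k=0}^n θ^k / ((k!)^α ((n-k)!)^β)`. -/
noncomputable def Cn (n : ℕ) (α β θ : ℝ) : ℝ :=
  ∑ k ∈ Finset.range (n + 1), θ ^ k / ((k.factorial : ℝ) ^ α * ((n - k).factorial : ℝ) ^ β)

/-- Probability mass function of `MCMPB_n(α,β,θ)` at `x`. -/
noncomputable def mcmpb (n : ℕ) (α β θ : ℝ) (x : ℕ) : ℝ :=
  θ ^ x / ((x.factorial : ℝ) ^ α * ((n - x).factorial : ℝ) ^ β * Cn n α β θ)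

/-- Converse part of Theorem 1: if the conditional distribution of `X₁` given
`X₁ + X₂ = y` is `MCMPB_y(α,β,θ)` for every `y`, then with `a = p₂(1)/p₂(0)` and
`b = p₁(0)/p₁(1)` one has `a·b·θ = 1`, `X₁ ∼ CMP(α, aθ)` and `X₂ ∼ CMP(β, a)`. -/
theorem cmp_of_conditional_mcmpb (α β θ : ℝ) (hθ : 0 < θ) (p1 p2 : ℕ → ℝ)
    (hp1 : ∀ x : ℕ, 0 < p1 x) (hp2 : ∀ x : ℕ, 0 < p2 x)
    (hcond : ∀ y : ℕ, ∀ x ≤ y,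
      p1 x * p2 (y - x) / (∑ k ∈ Finset.range (y + 1), p1 k * p2 (y - k)) =
        mcmpb y α β θ x) :
    (p2 1 / p2 0) * (p1 0 / p1 1) * θ = 1 ∧
    (∀ x : ℕ, p1 x = (p2 1 / p2 0 * θ) ^ x / (x.factorial : ℝ) ^ α * p1 0) ∧
    (∀ y : ℕ, p2 y = (p2 1 / p2 0) ^ y / (y.factorial : ℝ) ^ β * p2 0) := by
  have key : ∀ x z : ℕ, ∃ K : ℝ, ∀ s t : ℕ, s + t = x + z →
      (p1 s * (s.factorial : ℝ) ^ α / θ ^ s) * (p2 t * (t.factorial : ℝ) ^ β) = K := by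
    intro x z
    refine ⟨(∑ k ∈ Finset.range ((x + z) + 1), p1 k * p2 ((x + z) - k)) / Cn (x + z) α β θ, ?_⟩
    intro s t h
    have hc := hcond (x + z) s (by omega)
    have hz : x + z - s = t := by omega
    unfold mcmpb at hc
    rw [hz] at hc
    have hS : 0 < ∑ k ∈ Finset.range ((x + z) + 1), p1 k * p2 ((x + z) - k) :=
      Finset.sum_pos (fun k _ => mul_pos (hp1 _) (hp2 _)) ⟨0, by simp⟩
    have hC : 0 < Cn (x + z) α β θ := by
      unfold Cn
      refine Finset.sum_pos (fun k _ => ?_) ⟨0, by simp⟩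
      positivity
    have h1 : 0 < (s.factorial : ℝ) ^ α := by positivity
    have h2 : 0 < (t.factorial : ℝ) ^ β := by positivity
    have h3 : 0 < θ ^ s := by positivity
    generalize (∑ k ∈ Finset.range ((x + z) + 1), p1 k * p2 ((x + z) - k)) = S at *
    generalize Cn (x + z) α β θ = C at *
    generalize (s.factorial : ℝ) ^ α = A at *
    generalize (t.factorial : ℝ) ^ β = B at *
    generalize θ ^ s = T at *
    rw [div_eq_div_iff hS.ne' (by positivity)] at hc
    rw [div_mul_eq_mul_div]
    rw [div_eq_div_iff h3.ne' hC.ne']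
    linarith
  obtain ⟨u, hu⟩ : ∃ u : ℕ → ℝ, ∀ x, u x = p1 x * (x.factorial : ℝ) ^ α / θ ^ x :=
    ⟨_, fun _ => rfl⟩
  obtain ⟨v, hv⟩ : ∃ v : ℕ → ℝ, ∀ x, v x = p2 x * (x.factorial : ℝ) ^ β :=
    ⟨_, fun _ => rfl⟩
  have hst : ∀ x z, u (x + 1) * v z = u x * v (z + 1) := by
    intro x z
    obtain ⟨K, hK⟩ := key (x + 1) z
    rw [hu, hu, hv, hv, hK (x + 1) z rfl, hK x (z + 1) (by ring)]
  have hu0 : u 0 = p1 0 := by simp [hu]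
  have hu1 : u 1 = p1 1 / θ := by simp [hu]
  have hv0 : v 0 = p2 0 := by simp [hv]
  have hv1 : v 1 = p2 1 := by simp [hv]
  have q0 := hp1 0
  have q1 := hp1 1
  have r0 := hp2 0
  have r1 := hp2 1
  have h00 := hst 0 0
  rw [zero_add, hu0, hu1, hv0, hv1] at h00
  have hU : ∀ x, u x = (p2 1 / p2 0) ^ x * p1 0 := by
    intro x
    induction x with
    | zero => simp [hu0]
    | succ n ih =>
      have h := hst n 0
      rw [zero_add, hv0, hv1, ih] at h
      rw [pow_succ, eq_div_of_mul_eq r0.ne' h]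
      ring
  have hV : ∀ y, v y = (p2 1 / p2 0) ^ y * p2 0 := by
    intro y
    induction y with
    | zero => simp [hv0]
    | succ n ih =>
      have h := hst 0 n
      have h11 : p1 1 / θ = p1 0 * p2 1 / p2 0 := eq_div_of_mul_eq r0.ne' h00
      rw [zero_add, hu0, hu1, h11, ih] at h
      have : p1 0 * v (n + 1) = p1 0 * ((p2 1 / p2 0) ^ (n + 1) * p2 0) := by
        rw [← h, pow_succ]; ring
      exact mul_left_cancel₀ q0.ne' this
  refine ⟨?_, ?_, ?_⟩
  · field_simp at h00 ⊢
    linarith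
  · intro x
    have h := hU x
    have h1 : 0 < (x.factorial : ℝ) ^ α := by positivity
    have h3 : 0 < θ ^ x := by positivity
    rw [hu, div_eq_iff h3.ne'] at h
    rw [mul_pow, div_mul_eq_mul_div, eq_div_iff h1.ne', h]
    ring
  · intro y
    have h := hV y
    have h1 : 0 < (y.factorial : ℝ) ^ β := by positivity
    rw [hv] at h
    rw [div_mul_eq_mul_div, eq_div_iff h1.ne', h]
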